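/- Let d ≥ 1, let E = EuclideanSpace ℝ (Fin d), and let η₁ ∈ (0,1), κ₄ ∈ (0,1), γ₁ ∈ (0,1), ε > 0, κ₂ > 0, κ₃ > 0; set κ₅ = (1−η₁)·κ₄·ε/(1+κ₂+κ₃). Suppose F : E → ℝ is twice continuously differentiable with ‖D²F(y)‖ ≤ κ₂ for all y ∈ E, x ∈ E, g = ∇F(x) with ‖g‖ ≥ ε, A : E →L[ℝ] E with ‖A‖ ≤ κ₃, and m(p) = F(x) + ⟪g, p⟫ + (1/2)⟪p, A p⟫. Let r ∈ ℕ, and let Δ₀, Δ₁, ..., Δ_r be real numbers and d⁰, d¹, ..., d^{r−1} vectors in E such that for every j < r: Δ_j > 0, ‖d^j‖ ≤ Δ_j, the Cauchy decrease condition m(0) − m(d^j) ≥ κ₄·‖g‖·min(‖g‖/(1+‖A‖), Δ_j) holds, the step is rejected in the sense that F(x) − F(x + d^j) < η₁·(m(0) − m(d^j)), and Δ_{j+1} = γ₁·‖d^j‖. If Δ₀ ≥ γ₁·κ₅, then Δ_j ≥ γ₁·κ₅ for every j ≤ r. -/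

import Mathlib

open RealInnerProductSpace

/-- If the second derivative is bounded by `K`, the first-order Taylor remainder is at most
`K * ‖v‖ ^ 2`. -/
theorem norm_sub_sub_fderiv_le_of_norm_iteratedFDeriv_two_le
    {E G : Type*} [NormedAddCommGroup E] [NormedSpace ℝ E] [NormedAddCommGroup G]
    [NormedSpace ℝ G] {f : E → G} (hf : ContDiff ℝ 2 f) {K : ℝ}
    (hK : ∀ y, ‖iteratedFDeriv ℝ 2 f y‖ ≤ K) (x v : E) :
    ‖f (x + v) - f x - fderiv ℝ f x v‖ ≤ K * ‖v‖ ^ 2 := by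
  have hK0 : 0 ≤ K := (norm_nonneg _).trans (hK x)
  have hf' : ContDiff ℝ 1 (fderiv ℝ f) := hf.fderiv_right (by norm_num)
  have hbound : ∀ y, ‖fderiv ℝ (fderiv ℝ f) y‖ ≤ K := by
    intro y
    rw [← norm_iteratedFDeriv_one, norm_iteratedFDeriv_fderiv]
    exact hK y
  have hlip : ∀ y, ‖fderiv ℝ f y - fderiv ℝ f x‖ ≤ K * ‖y - x‖ := fun y =>
    convex_univ.norm_image_sub_le_of_norm_fderiv_le
      (fun z _ => hf'.differentiable (by norm_num) z) (fun z _ => hbound z)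
      (Set.mem_univ x) (Set.mem_univ y)
  have h := (convex_closedBall x ‖v‖).norm_image_sub_le_of_norm_fderiv_le'
    (𝕜 := ℝ) (f := f) (φ := fderiv ℝ f x) (C := K * ‖v‖) (x := x) (y := x + v)
    (fun z _ => hf.differentiable (by norm_num) z)
    (fun z hz => (hlip z).trans
      (mul_le_mul_of_nonneg_left (mem_closedBall_iff_norm.mp hz) hK0))
    (by simp) (by simp)
  simpa [pow_two, mul_assoc] using h

/-- Theorem 2 of the paper (inner repeat-loop version): along one run of the
trust-region step computation, in which the radius is shrunk by the factor `γ₁`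
after every rejected trial step, the trust-region radius never drops below
`γ₁ * κ₅`, provided it starts at least at `γ₁ * κ₅`. -/
theorem radius_not_too_small
    (d : ℕ) (hd : 1 ≤ d)
    (η₁ κ₄ γ₁ ε κ₂ κ₃ κ₅ : ℝ)
    (hη₁ : η₁ ∈ Set.Ioo (0 : ℝ) 1) (hκ₄ : κ₄ ∈ Set.Ioo (0 : ℝ) 1)
    (hγ₁ : γ₁ ∈ Set.Ioo (0 : ℝ) 1)
    (hε : 0 < ε) (hκ₂ : 0 < κ₂) (hκ₃ : 0 < κ₃)
    (hκ₅ : κ₅ = (1 - η₁) * κ₄ * ε / (1 + κ₂ + κ₃))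
    (F : EuclideanSpace ℝ (Fin d) → ℝ) (hF : ContDiff ℝ 2 F)
    (hF2 : ∀ y : EuclideanSpace ℝ (Fin d), ‖iteratedFDeriv ℝ 2 F y‖ ≤ κ₂)
    (x : EuclideanSpace ℝ (Fin d))
    (g : EuclideanSpace ℝ (Fin d)) (hg : g = gradient F x) (hgε : ‖g‖ ≥ ε)
    (A : EuclideanSpace ℝ (Fin d) →L[ℝ] EuclideanSpace ℝ (Fin d)) (hA : ‖A‖ ≤ κ₃)
    (m : EuclideanSpace ℝ (Fin d) → ℝ)
    (hm : ∀ p : EuclideanSpace ℝ (Fin d), m p = F x + ⟪g, p⟫ + (1 / 2) * ⟪p, A p⟫)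
    (r : ℕ) (Δ : ℕ → ℝ) (step : ℕ → EuclideanSpace ℝ (Fin d))
    (hΔpos : ∀ j < r, 0 < Δ j)
    (hstepΔ : ∀ j < r, ‖step j‖ ≤ Δ j)
    (hCauchy : ∀ j < r,
      m 0 - m (step j) ≥ κ₄ * ‖g‖ * min (‖g‖ / (1 + ‖A‖)) (Δ j))
    (hreject : ∀ j < r, F x - F (x + step j) < η₁ * (m 0 - m (step j)))
    (hshrink : ∀ j < r, Δ (j + 1) = γ₁ * ‖step j‖)
    (hΔ₀ : Δ 0 ≥ γ₁ * κ₅) :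
    ∀ j ≤ r, Δ j ≥ γ₁ * κ₅ := by
  obtain ⟨hη0, hη1⟩ := hη₁
  obtain ⟨hκ0, hκ1⟩ := hκ₄
  have hstep : ∀ j < r, κ₅ ≤ ‖step j‖ := by
    intro j hj
    by_contra! hlt
    set v := step j
    have hmodel : m 0 - m v = -⟪g, v⟫ - (1 / 2) * ⟪v, A v⟫ := by
      rw [hm, hm]
      simp
      ring
    have hquad : -⟪v, A v⟫ ≤ κ₃ * ‖v‖ ^ 2 := by
      have h1 : |⟪v, A v⟫| ≤ ‖v‖ * ‖A v‖ := abs_real_inner_le_norm v (A v)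
      have h2 : ‖A v‖ ≤ κ₃ * ‖v‖ := A.le_of_opNorm_le hA v
      nlinarith [neg_le_abs ⟪v, A v⟫, norm_nonneg v]
    have htaylor := norm_sub_sub_fderiv_le_of_norm_iteratedFDeriv_two_le hF hF2 x v
    rw [← inner_gradient_left, ← hg, Real.norm_eq_abs] at htaylor
    have hremainder := (le_abs_self _).trans htaylor
    have hκ₅g : κ₅ ≤ ‖g‖ / (1 + ‖A‖) := by
      rw [hκ₅]
      have h1 : (1 - η₁) * κ₄ ≤ 1 := by nlinarith
      have h2 : (1 - η₁) * κ₄ * ε ≤ ‖g‖ := by nlinarith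
      exact div_le_div₀ (norm_nonneg g) h2 (by positivity) (by linarith)
    have hpred : κ₄ * ε * ‖v‖ ≤ m 0 - m v := by
      refine le_trans ?_ (hCauchy j hj)
      have hmin : ‖v‖ ≤ min (‖g‖ / (1 + ‖A‖)) (Δ j) :=
        le_min (hlt.le.trans hκ₅g) (hstepΔ j hj)
      gcongr
    have hmul : κ₅ * (1 + κ₂ + κ₃) = (1 - η₁) * κ₄ * ε := by
      rw [hκ₅]
      field_simp
    have hrej : F x - F (x + v) < η₁ * (m 0 - m v) := hreject j hj
    have hupper : (1 - η₁) * (m 0 - m v) < (κ₂ + κ₃) * ‖v‖ ^ 2 := by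
      nlinarith [sq_nonneg ‖v‖]
    have hlower : (1 - η₁) * (κ₄ * ε * ‖v‖) ≤ (1 - η₁) * (m 0 - m v) :=
      mul_le_mul_of_nonneg_left hpred (by linarith)
    have hsq : ‖v‖ ^ 2 ≤ κ₅ * ‖v‖ := by nlinarith [norm_nonneg v]
    have hscaled : (κ₂ + κ₃) * ‖v‖ ^ 2 ≤ (1 + κ₂ + κ₃) * (κ₅ * ‖v‖) := by
      nlinarith [sq_nonneg ‖v‖]
    have heq : (1 + κ₂ + κ₃) * (κ₅ * ‖v‖) = (1 - η₁) * (κ₄ * ε * ‖v‖) := by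
      linear_combination ‖v‖ * hmul
    linarith
  intro j hj
  cases j with
  | zero => exact hΔ₀
  | succ k =>
    rw [hshrink k hj]
    exact mul_le_mul_of_nonneg_left (hstep k hj) hγ₁.1.le
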